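/- If F: A → B is an A∞ morphism whose first component F¹ is a chain map isomorphism (in particular for a strict A∞ isomorphism), then F admits an inverse A∞ morphism G: B → A with G ∘ F = id and F ∘ G = id (an honest inverse, not just up to homotopy). -/

import Mathlib

open scoped BigOperators

/-- The components of an A∞ morphism (or of an A∞ structure): the `s`-th component
is an `(s+1)`-multilinear map.  Thus `F 0` is the linear component `F¹`. -/
def AInfComps (R : Type*) [CommRing R] (M N : Type*) [AddCommGroup M] [Module R M]
    [AddCommGroup N] [Module R N] : Type _ :=
  (s : ℕ) → MultilinearMap R (fun _ : Fin (s + 1) => M) N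

/-- Insert the value `x` in place of the `c+1` consecutive entries
`a i, …, a (i+c)` of `a`. -/
def insertArg {M : Type*} {s c : ℕ} (hc : c ≤ s) {i : ℕ} (hi : i ≤ s - c)
    (a : Fin (s + 1) → M) (x : M) : Fin (s - c + 1) → M := fun t =>
  if h1 : (t : ℕ) < i then a ⟨t, by omega⟩
  else if h2 : (t : ℕ) = i then x
  else a ⟨(t : ℕ) + c, by have := t.isLt; omega⟩

/-- The left-hand side of the A∞ relations / A∞ morphism equations:
`Σ F^{s+1-j}(a₁,…,a_i, μ^j(a_{i+1},…,a_{i+j}), a_{i+j+1},…)` where the outer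
components are taken from `F` and the inner ones from `μ`. -/
def ainfLHS {R M N : Type*} [CommRing R] [AddCommGroup M] [Module R M]
    [AddCommGroup N] [Module R N] (μ : AInfComps R M M) (F : AInfComps R M N)
    (s : ℕ) (a : Fin (s + 1) → M) : N :=
  ∑ c : Fin (s + 1), ∑ i : Fin (s - (c : ℕ) + 1),
    F (s - (c : ℕ))
      (insertArg (Nat.lt_succ_iff.mp c.isLt) (Nat.lt_succ_iff.mp i.isLt) a
        (μ (c : ℕ) (fun u : Fin ((c : ℕ) + 1) =>
          a ⟨(i : ℕ) + u, by have := u.isLt; have := i.isLt; have := c.isLt; omega⟩)))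

/-- The A∞ relations (with signs omitted). -/
def IsAInfAlg {R M : Type*} [CommRing R] [AddCommGroup M] [Module R M]
    (μ : AInfComps R M M) : Prop :=
  ∀ (s : ℕ) (a : Fin (s + 1) → M), ainfLHS μ μ s a = 0

/-- Given components `F` and a composition `c` of `s`, apply the components of `F`
blockwise to the entries of `a`. -/
def blockArgs {R M N : Type*} [CommRing R] [AddCommGroup M] [Module R M]
    [AddCommGroup N] [Module R N] (F : AInfComps R M N) {n : ℕ} (c : Composition n)
    (a : Fin n → M) : Fin c.length → N := fun j =>
  F (c.blocksFun j - 1) (fun u : Fin (c.blocksFun j - 1 + 1) =>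
    a (c.embedding j ⟨(u : ℕ), by have := u.isLt; have := c.one_le_blocksFun j; omega⟩))

/-- The standard composition formula for components of A∞ morphisms:
`(G ∘ F)ˢ(a) = Σ_{i₁+⋯+i_k = s} G^k(F^{i₁}(a₁,…), …, F^{i_k}(…,a_s))`. -/
def ainfComp {R M N P : Type*} [CommRing R] [AddCommGroup M] [Module R M]
    [AddCommGroup N] [Module R N] [AddCommGroup P] [Module R P]
    (G : AInfComps R N P) (F : AInfComps R M N) (s : ℕ) (a : Fin (s + 1) → M) : P :=
  ∑ c : Composition (s + 1),
    G (c.length - 1) (fun j : Fin (c.length - 1 + 1) =>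
      blockArgs F c a ⟨(j : ℕ), by
        have := j.isLt; have := c.length_pos_of_pos (Nat.succ_pos s); omega⟩)

/-- The A∞ morphism equations (with signs omitted):
`Σ F^{s+1-j}(a₁,…, μ_A^j(…), …, a_s) = Σ μ_B^k(F^{i₁}(…), …, F^{i_k}(…))`. -/
def IsAInfHom {R M N : Type*} [CommRing R] [AddCommGroup M] [Module R M]
    [AddCommGroup N] [Module R N] (μA : AInfComps R M M) (μB : AInfComps R N N)
    (F : AInfComps R M N) : Prop :=
  ∀ (s : ℕ) (a : Fin (s + 1) → M), ainfLHS μA F s a = ainfComp μB F s a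

set_option linter.unusedSectionVars false

namespace AInfAux

/-- Sum over all ways of writing `a = u ++ v`. -/
def splitSum {A P : Type*} [AddCommGroup P] : (List A → List A → P) → List A → P
  | ψ, [] => ψ [] []
  | ψ, x :: a => ψ [] (x :: a) + splitSum (fun u v => ψ (x :: u) v) a

section split
variable {A P Q : Type*} [AddCommGroup P] [AddCommGroup Q]

theorem splitSum_congr (a : List A) : ∀ (ψ ψ' : List A → List A → P)
    (_ : ∀ u v, u ++ v = a → ψ u v = ψ' u v), splitSum ψ a = splitSum ψ' a := by
  induction a with
  | nil => intro ψ ψ' h; exact h _ _ rfl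
  | cons x a ih =>
    intro ψ ψ' h
    simp only [splitSum]
    rw [h [] (x :: a) rfl, ih _ _ (fun u v e => h (x :: u) v (by simp [e]))]

theorem splitSum_add (a : List A) : ∀ (ψ ψ' : List A → List A → P),
    splitSum (fun u v => ψ u v + ψ' u v) a = splitSum ψ a + splitSum ψ' a := by
  induction a with
  | nil => intro ψ ψ'; rfl
  | cons x a ih =>
    intro ψ ψ'
    simp only [splitSum]
    rw [ih]; abel

theorem splitSum_map (θ : P →+ Q) (a : List A) : ∀ (ψ : List A → List A → P),
    splitSum (fun u v => θ (ψ u v)) a = θ (splitSum ψ a) := by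
  induction a with
  | nil => intro ψ; rfl
  | cons x a ih =>
    intro ψ
    simp only [splitSum, map_add]
    rw [ih]

theorem splitSum_zero (a : List A) (ψ : List A → List A → P)
    (h : ∀ u v, u ++ v = a → ψ u v = 0) : splitSum ψ a = 0 := by
  rw [splitSum_congr a ψ (fun u v => (0 : P →+ P) (ψ u v)) (by simpa using h), splitSum_map]
  rfl

theorem splitSum_coassoc (a : List A) : ∀ (χ : List A → List A → List A → P),
    splitSum (fun u v => splitSum (fun v1 v2 => χ u v1 v2) v) a =
    splitSum (fun w v2 => splitSum (fun u v1 => χ u v1 v2) w) a := by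
  induction a with
  | nil => intro χ; rfl
  | cons x a ih =>
    intro χ
    simp only [splitSum]
    rw [ih, splitSum_add]; abel

theorem splitSum_left (a : List A) (ψ : List A → List A → P)
    (h : ∀ u v, u ++ v = a → u ≠ [] → ψ u v = 0) : splitSum ψ a = ψ [] a := by
  cases a with
  | nil => rfl
  | cons x a =>
    simp only [splitSum]
    rw [splitSum_zero, add_zero]
    intro u v e
    exact h _ _ (by simp [e]) (by simp)

theorem splitSum_right (a : List A) : ∀ (ψ : List A → List A → P)
    (_ : ∀ u v, u ++ v = a → v ≠ [] → ψ u v = 0), splitSum ψ a = ψ a [] := by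
  induction a with
  | nil => intro ψ h; rfl
  | cons x a ih =>
    intro ψ h
    simp only [splitSum]
    rw [h [] (x :: a) rfl (by simp), zero_add, ih]
    intro u v e
    exact h _ _ (by simp [e])

theorem splitSum_append_cons (x : A) (q p : List A) : ∀ (ψ : List A → List A → P),
    splitSum ψ (p ++ x :: q) = splitSum (fun u v => ψ u (v ++ x :: q)) p +
      splitSum (fun u v => ψ (p ++ x :: u) v) q := by
  induction p with
  | nil => intro ψ; rfl
  | cons y p ih =>
    intro ψ
    simp only [splitSum, List.cons_append]
    rw [ih]
    abel

theorem splitSum_eq_sum (a : List A) : ∀ (ψ : List A → List A → P),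
    splitSum ψ a = ∑ k : Fin (a.length + 1), ψ (a.take k) (a.drop k) := by
  induction a with
  | nil => intro ψ; simp [splitSum]
  | cons x a ih =>
    intro ψ
    simp only [splitSum]
    rw [ih, List.length_cons]
    conv_rhs => rw [Fin.sum_univ_succ]
    simp

end split

theorem sum_composition_succ {P : Type*} [AddCommGroup P] (f : List ℕ → P) (n : ℕ) :
    ∑ c : Composition (n + 1), f c.blocks =
      ∑ k : Fin (n + 1), ∑ c : Composition (n - k), f (((k : ℕ) + 1) :: c.blocks) := by
  rw [Finset.sum_sigma']
  symm
  refine Finset.sum_bij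
    (fun (x : Σ k : Fin (n + 1), Composition (n - k)) _ =>
      (⟨((x.1 : ℕ) + 1) :: x.2.blocks, ?_, ?_⟩ : Composition (n + 1))) ?_ ?_ ?_ ?_
  · intro i hi
    rcases List.mem_cons.1 hi with rfl | hi
    · omega
    · exact x.2.blocks_pos hi
  · have := x.1.isLt
    have := x.2.blocks_sum
    simp only [List.sum_cons]; omega
  · intro _ _; exact Finset.mem_univ _
  · rintro ⟨k, c⟩ _ ⟨k', c'⟩ _ h
    simp only [Composition.mk.injEq, List.cons.injEq] at h
    obtain rfl : k = k' := by ext; omega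
    obtain rfl : c = c' := Composition.ext h.2
    rfl
  · rintro ⟨bl, hp, hs⟩ _
    cases bl with
    | nil => simp at hs
    | cons b bl =>
      have hb : 0 < b := hp (by simp)
      simp only [List.sum_cons] at hs
      refine ⟨⟨⟨b - 1, by omega⟩, ⟨bl, fun h => hp (by simp [h]), by simp only; omega⟩⟩,
        Finset.mem_univ _, ?_⟩
      apply Composition.ext
      simp only [List.cons.injEq, and_true]
      omega
  · intro _ _; rfl

/-- Pullback of a function on words along a family `F`. -/
def pull {A B P : Type*} [AddCommGroup P] (F : List A → B) (φ : List B → P) (a : List A) : P :=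
  ∑ c : Composition a.length, φ ((a.splitWrtComposition c).map F)

section pull
variable {A B C P Q : Type*} [AddCommGroup P] [AddCommGroup Q]

theorem pull_nil (F : List A → B) (φ : List B → P) : pull F φ [] = φ [] := by
  unfold pull
  have h : ∀ c : Composition ([] : List A).length,
      φ ((([] : List A).splitWrtComposition c).map F) = φ [] := by
    intro c
    have : (([] : List A).splitWrtComposition c) = [] := by
      rw [← List.length_eq_zero_iff, List.length_splitWrtComposition]
      have := c.length_le
      simpa using this
    rw [this]; rfl
  rw [Finset.sum_congr rfl (fun c _ => h c), Finset.sum_const, Finset.card_univ]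
  have : Fintype.card (Composition ([] : List A).length) = 1 := by
    rw [composition_card]; rfl
  rw [this, one_smul]

theorem pull_cons (F : List A → B) (φ : List B → P) (x : A) (a : List A) :
    pull F φ (x :: a) =
      splitSum (fun u v => pull F (fun w => φ (F (x :: u) :: w)) v) a := by
  rw [splitSum_eq_sum]
  unfold pull
  simp only [List.splitWrtComposition]
  have := sum_composition_succ
    (fun bl => φ (((x :: a).splitWrtCompositionAux bl).map F)) a.length
  refine Eq.trans this ?_
  refine Finset.sum_congr rfl fun k _ => ?_
  simp only [List.splitWrtCompositionAux_cons, List.take_succ_cons, List.drop_succ_cons,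
    List.map_cons]
  rw [← List.length_drop]

theorem pull_congr (F : List A → B) (φ φ' : List B → P) (a : List A)
    (h : ∀ b : List B, b.length ≤ a.length → (a ≠ [] → b ≠ []) → φ b = φ' b) :
    pull F φ a = pull F φ' a := by
  unfold pull
  refine Finset.sum_congr rfl fun c _ => h _ ?_ ?_
  · simpa using c.length_le
  · intro ha hb
    have h1 := c.length_pos_of_pos (List.length_pos_iff.2 ha)
    have h2 := congrArg List.length hb
    simp only [List.length_map, List.length_splitWrtComposition, List.length_nil] at h2
    omega

theorem pull_add (F : List A → B) (φ φ' : List B → P) (a : List A) :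
    pull F (fun b => φ b + φ' b) a = pull F φ a + pull F φ' a := by
  unfold pull; exact Finset.sum_add_distrib

theorem pull_map (θ : P →+ Q) (F : List A → B) (φ : List B → P) (a : List A) :
    pull F (fun b => θ (φ b)) a = θ (pull F φ a) := by
  unfold pull; rw [map_sum]

theorem pull_zero (F : List A → B) (φ : List B → P) (a : List A)
    (h : ∀ b : List B, b.length ≤ a.length → (a ≠ [] → b ≠ []) → φ b = 0) :
    pull F φ a = 0 := by
  rw [pull_congr F φ (fun _ => 0) a h]; simp [pull]

theorem pull_ne (F : List A → B) (φ : List B → P) (h : ∀ w, φ (F [] :: w) = 0)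
    (a : List A) (ha : a ≠ []) :
    pull F φ a = splitSum (fun u v => pull F (fun w => φ (F u :: w)) v) a := by
  cases a with
  | nil => exact absurd rfl ha
  | cons x a =>
    rw [pull_cons]
    simp only [splitSum]
    rw [pull_zero F (fun w => φ (F [] :: w)) _ (fun b _ _ => h b), zero_add]

theorem pull_splitSum (F : List A → B) (n : ℕ) : ∀ (a : List A) (_ : a.length ≤ n)
    (ψ : List B → List B → P),
    pull F (fun b => splitSum ψ b) a =
      splitSum (fun a1 a2 => pull F (fun u => pull F (fun v => ψ u v) a2) a1) a := by
  induction n with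
  | zero =>
    intro a ha ψ
    obtain rfl := List.length_eq_zero_iff.1 (Nat.le_zero.1 ha)
    simp [pull_nil, splitSum]
  | succ n ih =>
    intro a ha ψ
    cases a with
    | nil => simp [pull_nil, splitSum]
    | cons x a =>
      simp only [List.length_cons] at ha
      rw [pull_cons]
      simp only [splitSum, pull_nil, pull_add]
      rw [splitSum_add, ← pull_cons F (ψ [])]
      congr 1
      rw [splitSum_congr a _ (fun u v => splitSum (fun v1 v2 =>
        pull F (fun s => pull F (fun t => ψ (F (x :: u) :: s) t) v2) v1) v)]
      · rw [splitSum_coassoc]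
        refine splitSum_congr _ _ _ fun u v _ => ?_
        rw [pull_cons]
      · intro u v e
        refine ih v ?_ _
        have := congrArg List.length e
        simp at this; omega

end pull

/-- The word-level action of a (sign-free) coderivation with components `μ`. -/
def der {A P : Type*} [AddCommGroup P] (μ : List A → A) : (List A → P) → List A → P
  | _, [] => 0
  | φ, x :: a => splitSum (fun u v => φ (μ (x :: u) :: v)) a + der μ (fun w => φ (x :: w)) a

section der
variable {A B P Q : Type*} [AddCommGroup P] [AddCommGroup Q]

theorem der_add (μ : List A → A) (a : List A) : ∀ (φ φ' : List A → P),
    der μ (fun b => φ b + φ' b) a = der μ φ a + der μ φ' a := by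
  induction a with
  | nil => intro φ φ'; simp [der]
  | cons x a ih =>
    intro φ φ'
    simp only [der]
    rw [splitSum_add, ih]; abel

theorem der_map (θ : P →+ Q) (μ : List A → A) (a : List A) : ∀ (φ : List A → P),
    der μ (fun b => θ (φ b)) a = θ (der μ φ a) := by
  induction a with
  | nil => intro φ; simp [der]
  | cons x a ih =>
    intro φ
    simp only [der, map_add]
    rw [ih, splitSum_map]

theorem der_congr (μ : List A → A) (a : List A) : ∀ (φ φ' : List A → P)
    (_ : ∀ b, b ≠ [] → φ b = φ' b), der μ φ a = der μ φ' a := by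
  induction a with
  | nil => intro φ φ' _; simp [der]
  | cons x a ih =>
    intro φ φ' h
    simp only [der]
    rw [ih _ (fun w => φ' (x :: w)) (fun b _ => h _ (by simp))]
    congr 1
    exact splitSum_congr _ _ _ fun u v _ => h _ (by simp)

theorem der_zero (μ : List A → A) (a : List A) (φ : List A → P)
    (h : ∀ b, b ≠ [] → φ b = 0) : der μ φ a = 0 := by
  rw [der_congr μ a φ (fun b => (0 : P →+ P) (φ b)) (by simpa using h), der_map]; rfl

theorem der_splitSum (μ : List A → A) (a : List A) : ∀ (ψ : List A → List A → P),
    der μ (fun b => splitSum ψ b) a =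
      splitSum (fun u v => der μ (fun u' => ψ u' v) u + der μ (ψ u) v) a := by
  induction a with
  | nil => intro ψ; simp [der, splitSum]
  | cons x a ih =>
    intro ψ
    simp only [der, splitSum]
    rw [der_add, splitSum_add, ih, splitSum_coassoc, splitSum_add, splitSum_add, splitSum_add]
    abel

end der

/-- Multilinearity of a function on words. -/
def ML (R : Type*) [CommRing R] {A P : Type*} [AddCommGroup A] [Module R A]
    [AddCommGroup P] [Module R P] (φ : List A → P) : Prop :=
  ∀ u w, IsLinearMap R (fun x => φ (u ++ x :: w))

/-- Projection of words onto letters. -/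
def proj {A : Type*} [AddCommGroup A] : List A → A
  | [x] => x
  | _ => 0

section ml
variable {R : Type*} [CommRing R] {A B C P : Type*} [AddCommGroup A] [Module R A]
  [AddCommGroup B] [Module R B] [AddCommGroup C] [Module R C]
  [AddCommGroup P] [Module R P]

theorem ML.cons {φ : List A → P} (h : ML R φ) (x : A) : ML R (fun w => φ (x :: w)) :=
  fun u w => h (x :: u) w

theorem ML.zero {φ : List A → P} (h : ML R φ) (w : List A) : φ (0 :: w) = 0 :=
  (h [] w).map_zero

theorem isLinearMap_pull (F : List A → B) (φ : C → List B → P)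
    (h : ∀ w, IsLinearMap R (fun x => φ x w)) (a : List A) :
    IsLinearMap R (fun x => pull F (φ x) a) := by
  constructor
  · intro x y
    simp only [pull, (h _).map_add, Finset.sum_add_distrib]
  · intro r x
    simp only [pull, (h _).map_smul, Finset.smul_sum]

theorem isLinearMap_splitSum (a : List A) (ψ : C → List A → List A → P)
    (h : ∀ u v, u ++ v = a → IsLinearMap R (fun x => ψ x u v)) :
    IsLinearMap R (fun x => splitSum (ψ x) a) := by
  constructor
  · intro x y
    rw [← splitSum_add]
    exact splitSum_congr _ _ _ fun u v e => (h u v e).map_add x y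
  · intro r x
    have := splitSum_map (DistribSMul.toAddMonoidHom P r) a (ψ x)
    refine Eq.trans ?_ this
    exact splitSum_congr _ _ _ fun u v e => (h u v e).map_smul r x

theorem isLinearMap_const_zero : IsLinearMap R (fun _ : C => (0 : P)) :=
  ⟨by simp, by simp⟩

theorem isLinearMap_add' {f g : C → P} (hf : IsLinearMap R f) (hg : IsLinearMap R g) :
    IsLinearMap R (fun x => f x + g x) :=
  (hf.mk' _ + hg.mk' _).isLinear

theorem isLinearMap_der (μ : List A → A) (a : List A) : ∀ (φ : C → List A → P)
    (_ : ∀ w, IsLinearMap R (fun x => φ x w)), IsLinearMap R (fun x => der μ (φ x) a) := by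
  induction a with
  | nil => intro φ _; exact isLinearMap_const_zero
  | cons y a ih =>
    intro φ h
    exact isLinearMap_add'
      (isLinearMap_splitSum a (fun x u v => φ x (μ (y :: u) :: v)) fun u v _ => h _)
      (ih (fun x w => φ x (y :: w)) fun w => h _)

theorem ML_der (μ : List A → A) (hμ : ML R μ) (p q : List A) : ∀ (φ : List A → P)
    (_ : ML R φ), IsLinearMap R (fun x => der μ φ (p ++ x :: q)) := by
  induction p with
  | nil =>
    intro φ hφ
    refine isLinearMap_add' (isLinearMap_splitSum q (fun x u v => φ (μ (x :: u) :: v)) ?_)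
      (isLinearMap_der μ q (fun x w => φ (x :: w)) fun w => hφ [] w)
    intro u v _
    exact ((hφ [] v).mk' _ ∘ₗ (hμ [] u).mk' _).isLinear
  | cons y p ih =>
    intro φ hφ
    have key : (fun x => der μ φ (y :: p ++ x :: q)) = fun x =>
        (splitSum (fun u v => φ (μ (y :: u) :: (v ++ x :: q))) p +
        splitSum (fun u v => φ (μ (y :: (p ++ x :: u)) :: v)) q) +
        der μ (fun w => φ (y :: w)) (p ++ x :: q) := by
      funext x
      rw [← splitSum_append_cons x q p (fun u v => φ (μ (y :: u) :: v))]
      rfl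
    rw [key]
    refine isLinearMap_add' (isLinearMap_add' ?_ ?_) (ih _ (hφ.cons y))
    · refine isLinearMap_splitSum p (fun x u v => φ (μ (y :: u) :: (v ++ x :: q))) ?_
      intro u v _
      exact hφ (μ (y :: u) :: v) q
    · refine isLinearMap_splitSum q (fun x u v => φ (μ (y :: (p ++ x :: u)) :: v)) ?_
      intro u v _
      exact ((hφ [] v).mk' _ ∘ₗ (hμ (y :: p) u).mk' _).isLinear

theorem der_proj (μ : List A → A) (h0 : μ [] = 0) (a : List A) : der μ proj a = μ a := by
  cases a with
  | nil => rw [h0]; rfl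
  | cons x a =>
    rw [der, splitSum_right, der_zero, add_zero]
    · rfl
    · intro b hb
      cases b with
      | nil => exact absurd rfl hb
      | cons y b => rfl
    · intro u v _ hv
      cases v with
      | nil => exact absurd rfl hv
      | cons y b => rfl

theorem ML_pull (F : List A → B) (hF : ML R F) (hF0 : F [] = 0) (n : ℕ) :
    ∀ (φ : List B → P) (_ : ML R φ) (u w : List A) (_ : (u ++ w).length ≤ n),
      IsLinearMap R (fun x => pull F φ (u ++ x :: w)) := by
  induction n using Nat.strong_induction_on with
  | _ n ih =>
  intro φ hφ p q hn
  have key : (fun x => pull F φ (p ++ x :: q)) = fun x =>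
      splitSum (fun u v => pull F (fun w => φ (F u :: w)) (v ++ x :: q)) p +
      splitSum (fun u v => pull F (fun w => φ (F (p ++ x :: u) :: w)) v) q := by
    funext x
    rw [pull_ne F φ (by rw [hF0]; exact hφ.zero) _ (by simp), splitSum_append_cons]
  rw [key]
  refine isLinearMap_add' ?_ ?_
  · refine isLinearMap_splitSum p
      (fun x u v => pull F (fun w => φ (F u :: w)) (v ++ x :: q)) ?_
    intro u v e
    cases u with
    | nil =>
      have : (fun x => pull F (fun w => φ (F [] :: w)) (v ++ x :: q)) = fun _ => 0 := by
        funext x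
        exact pull_zero _ _ _ fun b _ _ => by rw [hF0, hφ.zero]
      rw [this]; exact isLinearMap_const_zero
    | cons y u =>
      have := congrArg List.length e
      simp at this hn
      exact ih (v ++ q).length (by simp; omega) _ (hφ.cons _) v q le_rfl
  · refine isLinearMap_splitSum q
      (fun x u v => pull F (fun w => φ (F (p ++ x :: u) :: w)) v) ?_
    intro u v e
    refine isLinearMap_pull F (fun x w => φ (F (p ++ x :: u) :: w)) ?_ v
    intro w
    exact ((hφ [] w).mk' _ ∘ₗ (hF p u).mk' _).isLinear

theorem ML.pull {F : List A → B} (hF : ML R F) (hF0 : F [] = 0) {φ : List B → P}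
    (hφ : ML R φ) : ML R (AInfAux.pull F φ) :=
  fun u w => ML_pull F hF hF0 _ φ hφ u w le_rfl

theorem proj_nil : proj ([] : List A) = 0 := rfl

theorem ML_proj : ML R (proj : List A → A) := by
  intro u w
  match u, w with
  | [], [] => exact LinearMap.id.isLinear
  | [], y :: w => exact isLinearMap_const_zero
  | [z], w => exact isLinearMap_const_zero
  | z :: z' :: u, w => exact isLinearMap_const_zero

/-- `x ↦ pull F (φ (x :: ·)) v` as an additive map. -/
def theta (R : Type*) [CommRing R] {A B P : Type*} [AddCommGroup A] [Module R A]
    [AddCommGroup B] [Module R B] [AddCommGroup P] [Module R P]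
    (F : List A → B) (φ : List B → P) (hφ : ML R φ) (v : List A) : B →+ P :=
  ((isLinearMap_pull (R := R) F (fun x w => φ (x :: w)) (fun w => hφ [] w) v).mk' _).toAddMonoidHom

theorem theta_apply (F : List A → B) (φ : List B → P) (hφ : ML R φ) (v : List A) (x : B) :
    theta R F φ hφ v x = AInfAux.pull F (fun w => φ (x :: w)) v := rfl

theorem pull_assoc (F : List A → B) (G : List B → C) (hG0 : G [] = 0) (n : ℕ) :
    ∀ (a : List A) (_ : a.length = n) (φ : List C → P) (_ : ML R φ),
      AInfAux.pull F (AInfAux.pull G φ) a = AInfAux.pull (AInfAux.pull F G) φ a := by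
  induction n using Nat.strong_induction_on with
  | _ n ih =>
  intro a han φ hφ
  have h0 : AInfAux.pull F G [] = 0 := by rw [pull_nil, hG0]
  by_cases ha : a = []
  · subst ha; simp [pull_nil]
  rw [pull_congr F _ (fun b => splitSum (fun u v => AInfAux.pull G (fun w => φ (G u :: w)) v) b) a
    (fun b _ hb => pull_ne G φ (by rw [hG0]; exact hφ.zero) b (hb ha))]
  rw [pull_splitSum F _ a le_rfl, pull_ne _ φ (by rw [h0]; exact hφ.zero) a ha]
  refine splitSum_congr _ _ _ fun u v e => ?_
  cases u with
  | nil =>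
    rw [pull_nil, h0, hG0]
    rw [pull_zero, pull_zero]
    · intro b _ _; exact hφ.zero b
    · intro b _ _; exact pull_zero _ _ _ fun b _ _ => hφ.zero b
  | cons x u =>
    have hl := congrArg List.length e
    simp at hl
    rw [← theta_apply (AInfAux.pull F G) φ hφ, ← pull_map]
    refine pull_congr _ _ _ _ fun b _ _ => ?_
    rw [theta_apply]
    exact ih v.length (by omega) v rfl _ (hφ.cons _)

theorem der_pull (μA : List A → A) (μB : List B → B) (hB0 : μB [] = 0)
    (F : List A → B) (hF0 : F [] = 0)
    (hF : ∀ a, der μA F a = AInfAux.pull F μB a) (n : ℕ) :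
    ∀ (a : List A) (_ : a.length = n) (φ : List B → P) (_ : ML R φ),
      der μA (AInfAux.pull F φ) a = AInfAux.pull F (der μB φ) a := by
  induction n using Nat.strong_induction_on with
  | _ n ih =>
  intro a han φ hφ
  by_cases ha : a = []
  · subst ha; simp [pull_nil, der]
  rw [der_congr μA a _ _ (pull_ne F φ (by rw [hF0]; exact hφ.zero)), der_splitSum, splitSum_add]
  have h1 : ∀ b, der μB φ b = splitSum (fun u v => φ (μB u :: v)) b +
      (match b with | [] => 0 | x :: b => der μB (fun w => φ (x :: w)) b) := by
    intro b
    cases b with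
    | nil => simp [der, splitSum, hB0, hφ.zero]
    | cons x b => simp [der, splitSum, hB0, hφ.zero]
  rw [pull_congr F _ _ a (fun b _ _ => h1 b), pull_add, pull_splitSum F _ a le_rfl]
  congr 1
  · refine splitSum_congr _ _ _ fun u v e => ?_
    have e1 := der_map (theta R F φ hφ v) μA u F
    have e2 := pull_map (theta R F φ hφ v) F μB u
    simp only [theta_apply] at e1 e2
    rw [e1, e2, hF]
  · rw [pull_ne F _ _ a ha]
    · refine splitSum_congr _ _ _ fun u v e => ?_
      cases u with
      | nil =>
        rw [hF0, der_zero, pull_zero]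
        · intro b _ _; exact der_zero _ _ _ fun b _ => hφ.zero b
        · intro b _; exact pull_zero _ _ _ fun b _ _ => hφ.zero b
      | cons x u =>
        have hl := congrArg List.length e
        simp at hl
        exact ih v.length (by omega) v rfl _ (hφ.cons _)
    · intro w
      rw [hF0]
      exact der_zero _ _ _ fun b _ => hφ.zero b

theorem pull_proj (F : List A → B) (hF0 : F [] = 0) (a : List A) :
    AInfAux.pull F proj a = F a := by
  by_cases ha : a = []
  · subst ha; rw [pull_nil, hF0]; rfl
  rw [pull_ne F proj (by rw [hF0]; exact (ML_proj (R := ℤ)).zero) a ha, splitSum_right]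
  · rw [pull_nil]; rfl
  · intro u v _ hv
    refine pull_zero _ _ _ fun b _ hb => ?_
    cases b with
    | nil => exact absurd rfl (hb hv)
    | cons y b => rfl

theorem proj_pull (n : ℕ) : ∀ (a : List A) (_ : a.length = n) (φ : List A → P) (_ : ML R φ),
    AInfAux.pull proj φ a = φ a := by
  induction n using Nat.strong_induction_on with
  | _ n ih =>
  intro a han φ hφ
  cases a with
  | nil => rw [pull_nil]
  | cons x a =>
    rw [pull_cons, splitSum_left]
    · exact ih a.length (by simp at han; omega) a rfl _ (hφ.cons _)
    · intro u v _ hu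
      refine pull_zero _ _ _ fun b _ _ => ?_
      cases u with
      | nil => exact absurd rfl hu
      | cons y u => exact hφ.zero b

theorem pull_top (F : List A → B) (a : List A) : ∀ (φ : List B → P)
    (_ : ∀ b, b.length < a.length → φ b = 0),
    AInfAux.pull F φ a = φ (a.map (fun x => F [x])) := by
  induction a with
  | nil => intro φ _; rw [pull_nil]; rfl
  | cons x a ih =>
    intro φ h
    rw [pull_cons, splitSum_left]
    · exact ih _ (fun b hb => h _ (by simpa using hb))
    · intro u v e hu
      refine pull_zero _ _ _ fun b hb _ => h _ ?_
      have := congrArg List.length e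
      have := List.length_pos_iff.2 hu
      simp at *
      omega

/-- Recursive approximations of the left inverse of `F`. -/
def approx (F : List A → B) (e : B → A) : ℕ → List B → A
  | 0, _ => 0
  | n + 1, b => if b.length = n + 1 then proj (b.map e) - AInfAux.pull F (approx F e n) (b.map e)
      else approx F e n b

theorem approx_gt (F : List A → B) (e : B → A) (n : ℕ) (b : List B) (h : n < b.length) :
    approx F e n b = 0 := by
  induction n with
  | zero => rfl
  | succ n ih => rw [approx, if_neg (by omega), ih (by omega)]

theorem approx_stable (F : List A → B) (e : B → A) (n : ℕ) (b : List B) (h : b.length ≤ n) :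
    approx F e n b = approx F e b.length b := by
  induction n with
  | zero =>
    have : b.length = 0 := by omega
    rw [this]
  | succ n ih =>
    by_cases hb : b.length = n + 1
    · rw [hb]
    · rw [approx, if_neg hb, ih (by omega)]

theorem ML_approx (F : List A → B) (hF : ML R F) (hF0 : F [] = 0) (e : B →ₗ[R] A) (n : ℕ) :
    ML R (approx F e n) := by
  induction n with
  | zero => intro u w; exact isLinearMap_const_zero
  | succ n ih =>
    intro u w
    by_cases h : (u ++ w).length + 1 = n + 1
    · have : (fun x => approx F e (n + 1) (u ++ x :: w)) = fun x =>
        proj (u.map e ++ e x :: w.map e) -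
          AInfAux.pull F (approx F e n) (u.map e ++ e x :: w.map e) := by
        funext x
        rw [approx, if_pos (by simp at *; omega)]
        simp
      rw [this]
      exact ((ML_proj (u.map e) (w.map e)).mk' _ ∘ₗ e -
        (hF.pull hF0 ih (u.map e) (w.map e)).mk' _ ∘ₗ e).isLinear
    · have : (fun x => approx F e (n + 1) (u ++ x :: w)) = fun x =>
        approx F e n (u ++ x :: w) := by
        funext x
        rw [approx, if_neg (by simp at *; omega)]
      rw [this]
      exact ih u w

theorem exists_leftInv (F : List A → B) (hF : ML R F) (hF0 : F [] = 0) (e : B →ₗ[R] A)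
    (he : ∀ x, e (F [x]) = x) :
    ∃ G : List B → A, ML R G ∧ G [] = 0 ∧ (∀ y, G [y] = e y) ∧
      ∀ a, AInfAux.pull F G a = proj a := by
  refine ⟨fun b => approx F e b.length b, ?_, rfl, ?_, ?_⟩
  · intro u w
    have := ML_approx F hF hF0 e (u.length + w.length + 1) u w
    convert this using 3
    simp; omega
  · intro y
    simp only [List.length_singleton, approx, if_true, List.map_cons, List.map_nil]
    rw [pull_zero _ _ _ (fun _ _ _ => rfl), sub_zero]; rfl
  · intro a
    cases a with
    | nil => rw [pull_nil]; rfl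
    | cons x a =>
      have h := pull_add F (approx F e a.length)
        (fun b => approx F e b.length b - approx F e a.length b) (x :: a)
      simp only [add_sub_cancel] at h
      rw [h, pull_top F (x :: a)
        (fun b => approx F e b.length b - approx F e a.length b)]
      · rw [approx_gt F e a.length ((x :: a).map (fun x => F [x])) (by simp), sub_zero]
        have hl : ((x :: a).map (fun x => F [x])).length = a.length + 1 := by simp
        rw [hl, approx, if_pos hl]
        have hm : ((x :: a).map (fun x => F [x])).map e = x :: a := by
          rw [List.map_map]
          conv_rhs => rw [← List.map_id (x :: a)]
          exact List.map_congr_left fun y _ => he y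
        rw [hm, add_sub_cancel]
      · intro b hb
        rw [approx_stable F e a.length b (by simp at hb; omega), sub_self]

theorem exists_inverse (F : List A → B) (hF : ML R F) (hF0 : F [] = 0) (e : B →ₗ[R] A)
    (he : ∀ x, e (F [x]) = x) (he' : ∀ y, F [e y] = y)
    (μA : List A → A) (μB : List B → B) (hB : ML R μB) (hA0 : μA [] = 0)
    (hB0 : μB [] = 0) (hFμ : ∀ a, der μA F a = AInfAux.pull F μB a) :
    ∃ G : List B → A, ML R G ∧ G [] = 0 ∧ (∀ a, AInfAux.pull F G a = proj a) ∧
      (∀ b, AInfAux.pull G F b = proj b) ∧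
      ∀ b, der μB G b = AInfAux.pull G μA b := by
  obtain ⟨G, hG, hG0, hG1, hFG⟩ := exists_leftInv F hF hF0 e he
  have hlin : IsLinearMap R (fun x => F [x]) := hF [] []
  obtain ⟨K, hK, hK0, -, hGK⟩ := exists_leftInv G hG hG0 (hlin.mk' _)
    (fun x => by rw [hG1]; exact he' x)
  have hFG' : AInfAux.pull F G = proj := funext hFG
  have hGK' : AInfAux.pull G K = proj := funext hGK
  -- pulling back along `G` and then along `F` is the identity
  have h1B : ∀ φ : List A → B, ML R φ → AInfAux.pull F (AInfAux.pull G φ) = φ := by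
    intro φ hφ; funext a
    rw [pull_assoc (R := R) F G hG0 _ a rfl φ hφ, hFG', proj_pull (R := R) _ a rfl φ hφ]
  have hFK : F = K := by
    have := h1B (AInfAux.pull K proj) (hK.pull hK0 ML_proj)
    rw [show AInfAux.pull K proj = K from funext (pull_proj K hK0), hGK',
      show AInfAux.pull F proj = F from funext (pull_proj F hF0)] at this
    exact this
  have hGF : AInfAux.pull G F = proj := by rw [hFK]; exact hGK'
  refine ⟨G, hG, hG0, hFG, fun b => by rw [hGF], ?_⟩
  intro b
  have h2 : ∀ φ : List B → A, ∀ c, ML R φ → AInfAux.pull G (AInfAux.pull F φ) c = φ c := by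
    intro φ c hφ
    rw [pull_assoc (R := R) G F hF0 _ c rfl φ hφ, hGF, proj_pull (R := R) _ c rfl φ hφ]
  have h3 : AInfAux.pull F (der μB G) = μA := by
    funext a
    rw [← der_pull (R := R) μA μB hB0 F hF0 hFμ _ a rfl G hG, hFG', der_proj μA hA0]
  rw [← h2 (der μB G) b (fun u w => ML_der μB hB u w G hG), h3]

end ml
end AInfAux

namespace AInfAux

theorem der_eq_sum {A P : Type*} [AddCommGroup P] (μ : List A → A) (a : List A) :
    ∀ φ : List A → P, der μ φ a = ∑ i ∈ Finset.range a.length,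
      ∑ k ∈ Finset.range (a.length - i),
        φ (a.take i ++ μ ((a.drop i).take (k + 1)) :: a.drop (i + k + 1)) := by
  induction a with
  | nil => intro φ; simp [der]
  | cons x a ih =>
    intro φ
    rw [der, ih, splitSum_eq_sum, List.length_cons, Finset.sum_range_succ', add_comm]
    congr 1
    · refine Finset.sum_congr rfl fun i _ => ?_
      rw [Nat.add_sub_add_right]
      refine Finset.sum_congr rfl fun k _ => ?_
      rw [show i + 1 + k + 1 = (i + k + 1) + 1 by omega]
      simp
    · rw [Nat.sub_zero, Finset.sum_range]
      refine Finset.sum_congr rfl fun k _ => ?_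
      simp

section trans
variable {R : Type*} [CommRing R] {M N P : Type*} [AddCommGroup M] [Module R M]
  [AddCommGroup N] [Module R N] [AddCommGroup P] [Module R P]

/-- The function on words associated with a family of components. -/
def toL (F : AInfComps R M N) : List M → N
  | [] => 0
  | x :: a => F a.length (x :: a).get

theorem toL_of (F : AInfComps R M N) (l : List M) (k : ℕ) (f : Fin (k + 1) → M)
    (h : l = List.ofFn f) : toL F l = F k f := by
  cases l with
  | nil => simp at h
  | cons x a =>
    have hl : a.length = k := by simpa using congrArg List.length h
    subst hl
    have : (x :: a).get = f := by
      apply List.ofFn_injective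
      rw [List.ofFn_get]; exact h
    simp only [toL]
    exact congrArg _ this

theorem ofFn_update {n : ℕ} (f : Fin n → M) (i : Fin n) (x : M) :
    List.ofFn (Function.update f i x) =
      (List.ofFn f).take i ++ x :: (List.ofFn f).drop (i + 1) := by
  have h : List.ofFn (Function.update f i x) = (List.ofFn f).set i x := by
    apply List.ext_getElem
    · simp
    · intro j h1 h2
      simp only [List.getElem_ofFn, List.getElem_set, Function.update_apply, Fin.ext_iff]
      simp only [eq_comm]
  rw [h, List.set_eq_take_append_cons_drop, if_pos (by simp)]

theorem ML_toL (F : AInfComps R M N) : ML R (toL F) := by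
  intro u w
  have key : ∀ x, toL F (u ++ x :: w) = F (u.length + w.length)
      (Function.update (fun i : Fin (u.length + w.length + 1) =>
        (u ++ (0 : M) :: w).get (i.cast (by simp; omega))) ⟨u.length, by omega⟩ x) := by
    intro x
    apply toL_of
    apply List.ext_getElem
    · simp; omega
    · intro j h1 h2
      simp only [List.getElem_ofFn, Function.update_apply, Fin.ext_iff]
      simp only [List.get_eq_getElem, Fin.val_cast]
      by_cases hj : j = u.length
      · subst hj; simp
      · rw [if_neg hj]
        simp only [List.getElem_append, List.getElem_cons]
        split_ifs <;> first | rfl | omega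
  constructor
  · intro x y; simp only [key]; exact MultilinearMap.map_update_add _ _ _ _ _
  · intro r x; simp only [key]; exact MultilinearMap.map_update_smul _ _ _ _ _

/-- The family of components associated with a multilinear function on words. -/
def ofL (φ : List M → N) (hφ : ML R φ) : AInfComps R M N := fun s =>
  { toFun := fun a => φ (List.ofFn a)
    map_update_add' := by
      intro d m i x y
      rw [Subsingleton.elim d (fun a b => instDecidableEqFin _ a b)]
      simp only [ofFn_update]
      exact (hφ _ _).map_add x y
    map_update_smul' := by
      intro d m i r x
      rw [Subsingleton.elim d (fun a b => instDecidableEqFin _ a b)]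
      simp only [ofFn_update]
      exact (hφ _ _).map_smul r x }

theorem toL_ofL (φ : List M → N) (hφ : ML R φ) (h0 : φ [] = 0) : toL (ofL φ hφ) = φ := by
  funext l
  cases l with
  | nil => exact h0.symm
  | cons x a => exact congrArg φ (List.ofFn_get (x :: a))

theorem pull_eq {A B : Type*} (F : List A → B) (φ : List B → P) (l : List A) (n : ℕ)
    (h : l.length = n) :
    pull F φ l = ∑ c : Composition n, φ ((l.splitWrtComposition c).map F) := by
  subst h; rfl

theorem ainfComp_eq (G : AInfComps R N P) (F : AInfComps R M N) (s : ℕ) (a : Fin (s + 1) → M) :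
    ainfComp G F s a = pull (toL F) (toL G) (List.ofFn a) := by
  rw [pull_eq _ _ _ (s + 1) (by simp)]
  unfold ainfComp
  refine Finset.sum_congr rfl fun c _ => ?_
  symm
  apply toL_of
  have hc := c.length_pos_of_pos (Nat.succ_pos s)
  apply List.ext_getElem
  · simp; omega
  · intro i h1 h2
    have hi : i < c.length := by simpa using h1
    simp only [List.getElem_map, List.getElem_ofFn, blockArgs]
    apply toL_of
    rw [List.getElem_splitWrtComposition]
    have hs := c.sizeUpTo_succ hi
    have hb : c.blocksFun ⟨i, hi⟩ = c.blocks[i] := rfl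
    have hb1 := c.one_le_blocksFun ⟨i, hi⟩
    have hle := c.sizeUpTo_le (i + 1)
    apply List.ext_getElem
    · simp; omega
    · intro j h3 h4
      simp only [List.getElem_drop, List.getElem_take, List.getElem_ofFn]
      rfl

theorem ainfLHS_eq (μ : AInfComps R M M) (F : AInfComps R M N) (s : ℕ) (a : Fin (s + 1) → M) :
    ainfLHS μ F s a = der (toL μ) (toL F) (List.ofFn a) := by
  rw [der_eq_sum, List.length_ofFn]
  set g : ℕ → ℕ → N := fun i k => toL F ((List.ofFn a).take i ++
    toL μ (((List.ofFn a).drop i).take (k + 1)) :: (List.ofFn a).drop (i + k + 1)) with hg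
  have h1 : ainfLHS μ F s a = ∑ c : Fin (s + 1), ∑ i : Fin (s - (c : ℕ) + 1), g i c := by
    unfold ainfLHS
    refine Finset.sum_congr rfl fun c _ => Finset.sum_congr rfl fun i _ => ?_
    symm
    have hc := c.isLt
    have hi := i.isLt
    apply toL_of
    have hμ : toL μ (((List.ofFn a).drop i).take (c + 1)) = μ (c : ℕ)
        (fun u : Fin ((c : ℕ) + 1) => a ⟨(i : ℕ) + u, by have := u.isLt; omega⟩) := by
      apply toL_of
      apply List.ext_getElem
      · simp; omega
      · intro j h3 h4
        simp only [List.getElem_ofFn, List.getElem_take, List.getElem_drop]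
    rw [hμ]
    apply List.ext_getElem
    · simp; omega
    · intro j h3 h4
      simp only [List.getElem_ofFn, insertArg, List.getElem_append, List.getElem_cons,
        List.length_take, List.length_ofFn, List.getElem_take, List.getElem_drop]
      have hmin : min (i : ℕ) (s + 1) = i := by omega
      by_cases hj : j < i
      · rw [dif_pos (by omega), dif_pos hj]
      · rw [dif_neg (by omega), dif_neg hj]
        by_cases hj' : j = i
        · rw [dif_pos (by omega), dif_pos hj']
        · rw [dif_neg (by omega), dif_neg hj']
          congr 2
          omega
  rw [h1, Finset.sum_range fun i => ∑ k ∈ Finset.range (s + 1 - i), g i k]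
  have h2 : ∀ c : Fin (s + 1), ∑ i : Fin (s - (c : ℕ) + 1), g i c =
      ∑ i ∈ Finset.range (s - (c : ℕ) + 1), g i c := 
    fun c => (Finset.sum_range (fun i => g i c)).symm
  simp only [h2]
  rw [← Finset.sum_range (fun c => ∑ i ∈ Finset.range (s - c + 1), g i c),
    ← Finset.sum_range fun i => ∑ k ∈ Finset.range (s + 1 - i), g i k]
  apply Finset.sum_comm'
  intro x y
  simp only [Finset.mem_range]
  omega

theorem toL_hom (μA : AInfComps R M M) (μB : AInfComps R N N) (F : AInfComps R M N)
    (hF : IsAInfHom μA μB F) (a : List M) :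
    der (toL μA) (toL F) a = pull (toL F) (toL μB) a := by
  cases a with
  | nil => rw [pull_nil]; rfl
  | cons x a =>
    have := hF a.length (x :: a).get
    rw [ainfLHS_eq, ainfComp_eq] at this
    have h : List.ofFn (n := a.length + 1) (x :: a).get = x :: a := List.ofFn_get (x :: a)
    rwa [h] at this

theorem proj_ofFn_zero (a : Fin 1 → M) : proj (List.ofFn a) = a 0 := by
  simp [proj]

theorem proj_ofFn_succ (s : ℕ) (hs : 1 ≤ s) (a : Fin (s + 1) → M) : proj (List.ofFn a) = 0 := by
  obtain ⟨t, rfl⟩ : ∃ t, s = t + 1 := ⟨s - 1, by omega⟩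
  simp [List.ofFn_succ, proj]

end trans
end AInfAux

/-- If F: A → B is an A∞ morphism whose first component F¹ is a chain
map isomorphism, then F admits an inverse A∞ morphism G: B → A with G ∘ F = id and
F ∘ G = id (an honest inverse, not just up to homotopy).  Here `G ∘ F = id` means
that the composite has first component the identity and vanishing higher
components. -/
theorem ainfty_morphism_with_invertible_first_component_has_inverse
    {R M N : Type*} [CommRing R] [AddCommGroup M] [Module R M]
    [AddCommGroup N] [Module R N]
    (μA : AInfComps R M M) (μB : AInfComps R N N)
    (hA : IsAInfAlg μA) (hB : IsAInfAlg μB)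
    (F : AInfComps R M N) (hF : IsAInfHom μA μB F)
    -- F¹ is an isomorphism (it is a chain map by the A∞ morphism equations)
    (hF1 : Function.Bijective (fun x : M => F 0 (fun _ => x))) :
    ∃ G : AInfComps R N M, IsAInfHom μB μA G ∧
      (∀ a : Fin 1 → M, ainfComp G F 0 a = a 0) ∧
      (∀ s : ℕ, 1 ≤ s → ∀ a : Fin (s + 1) → M, ainfComp G F s a = 0) ∧
      (∀ b : Fin 1 → N, ainfComp F G 0 b = b 0) ∧
      (∀ s : ℕ, 1 ≤ s → ∀ b : Fin (s + 1) → N, ainfComp F G s b = 0) := by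
  classical
  let L : M →ₗ[R] N := ((AInfAux.ML_toL F) [] []).mk' _
  have hL : ∀ x, L x = F 0 (fun _ => x) := fun x => by
    refine AInfAux.toL_of F [x] 0 (fun _ => x) ?_
    simp
  have hbij : Function.Bijective L := by
    have : (L : M → N) = fun x : M => F 0 (fun _ => x) := funext hL
    rw [this]; exact hF1
  let E := LinearEquiv.ofBijective L hbij
  have hE : ∀ x, AInfAux.toL F [x] = E x := fun x => rfl
  obtain ⟨G, hG, hG0, hFG, hGF, hGμ⟩ := AInfAux.exists_inverse (R := R) (AInfAux.toL F)
    (AInfAux.ML_toL F) rfl E.symm.toLinearMap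
    (fun x => by rw [hE]; exact E.symm_apply_apply x)
    (fun y => by rw [hE]; exact E.apply_symm_apply y)
    (AInfAux.toL μA) (AInfAux.toL μB) (AInfAux.ML_toL μB) rfl rfl
    (AInfAux.toL_hom μA μB F hF)
  have hT := AInfAux.toL_ofL G hG hG0
  refine ⟨AInfAux.ofL G hG, ?_, ?_, ?_, ?_, ?_⟩
  · intro s a
    rw [AInfAux.ainfLHS_eq, AInfAux.ainfComp_eq, hT, hGμ]
  · intro a
    rw [AInfAux.ainfComp_eq, hT, hFG, AInfAux.proj_ofFn_zero]
  · intro s hs a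
    rw [AInfAux.ainfComp_eq, hT, hFG, AInfAux.proj_ofFn_succ s hs]
  · intro b
    rw [AInfAux.ainfComp_eq, hT, hGF, AInfAux.proj_ofFn_zero]
  · intro s hs b
    rw [AInfAux.ainfComp_eq, hT, hGF, AInfAux.proj_ofFn_succ s hs]
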